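/- For every n ≥ 1 there exists an instance of P2||Cmax with 3n + 1 jobs (namely the exponential lower-bound instance with parameter n) and a sequence of schedules σ₀, σ₁, …, σ_T with T ≥ 2^n − 1 such that for every t < T, σ_{t+1} differs from σ_t on exactly 3 jobs and Cmax σ_{t+1} < Cmax σ_t. Hence the number of improving 3-swaps performed before a 3-swap optimal solution is reached can be 2^{Ω(n)} in the number of jobs. -/

import Mathlib

/-- The jobs of the exponential lower-bound instance with parameter `n`:
jobs `a i`, `b i`, `c i` for each `i : Fin n` (`i` standing for the 1-based index
`i + 1`), together with the large job `l`. -/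
inductive LBJob (n : ℕ) where
  | a (i : Fin n)
  | b (i : Fin n)
  | c (i : Fin n)
  | l
  deriving DecidableEq, Fintype

/-- Processing times of the lower-bound instance: with 1-based index `i' = i + 1`,
`p (a i') = 2^(n+i'+1) + 2^(i'-1)`, `p (b i') = 2^(n+i')`,
`p (c i') = 2^(n+i'-1) + 2^(i'-1)`, and `p l = 2^(2n+4)`. -/
def lbp (n : ℕ) : LBJob n → ℕ
  | .a i => 2 ^ (n + i.1 + 2) + 2 ^ i.1
  | .b i => 2 ^ (n + i.1 + 1)
  | .c i => 2 ^ (n + i.1) + 2 ^ i.1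
  | .l => 2 ^ (2 * n + 4)

/-- Load of a machine (`false` = machine 1, `true` = machine 2). -/
def lbLoad (n : ℕ) (m : Bool) (σ : LBJob n → Bool) : ℕ :=
  ∑ j ∈ Finset.univ.filter (fun j => σ j = m), lbp n j

/-- Makespan of a schedule of the lower-bound instance. -/
def lbCmax (n : ℕ) (σ : LBJob n → Bool) : ℕ :=
  max (lbLoad n false σ) (lbLoad n true σ)

/-! ### Helper material

A schedule with the big job `l` on machine 2 is encoded by the finset `S` of the jobs on machine 2. -/

/-- An improving 3-swap between two sets of jobs on the machine of `l`. -/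
def LBStep (n : ℕ) (S S' : Finset (LBJob n)) : Prop :=
  LBJob.l ∈ S ∧ LBJob.l ∈ S' ∧ (symmDiff S S').card = 3 ∧ ∑ j ∈ S', lbp n j < ∑ j ∈ S, lbp n j

/-- A chain of `k` improving 3-swaps from `S` to `S'`. -/
inductive LBChain (n : ℕ) : ℕ → Finset (LBJob n) → Finset (LBJob n) → Prop
  | refl (S) : LBChain n 0 S S
  | head {k S S' S''} : LBStep n S S' → LBChain n k S' S'' → LBChain n (k + 1) S S''

theorem LBChain.trans {n k m : ℕ} {S S' S'' : Finset (LBJob n)} (h : LBChain n k S S')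
    (h' : LBChain n m S' S'') : LBChain n (k + m) S S'' := by
  induction h with
  | refl S => simpa using h'
  | head hs _ ih =>
    have := LBChain.head hs (ih h')
    rwa [Nat.add_right_comm] at this

theorem LBChain.single {n : ℕ} {S S' : Finset (LBJob n)} (h : LBStep n S S') :
    LBChain n 1 S S' := LBChain.head h (LBChain.refl _)

theorem LBChain.exists_fun {n k : ℕ} {S S' : Finset (LBJob n)} (h : LBChain n k S S') :
    ∃ f : ℕ → Finset (LBJob n), f 0 = S ∧ ∀ t < k, LBStep n (f t) (f (t + 1)) := by
  induction h with
  | refl S => exact ⟨fun _ => S, rfl, by simp⟩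
  | @head k S S' S'' hs _ ih =>
    obtain ⟨f, h0, hf⟩ := ih
    refine ⟨fun t => Nat.casesOn t S f, rfl, ?_⟩
    intro t ht
    cases t with
    | zero => simpa [h0] using hs
    | succ t => exact hf t (by omega)

/-- Replace one job by two lighter ones. -/
theorem LBStep.split {n : ℕ} {S S' : Finset (LBJob n)} {x y z : LBJob n}
    (hl : LBJob.l ∈ S) (hxl : x ≠ LBJob.l) (hx : x ∈ S) (hy : y ∉ S) (hz : z ∉ S) (hyz : y ≠ z)
    (hS : S' = insert y (insert z (S.erase x)))
    (hp : lbp n y + lbp n z < lbp n x) : LBStep n S S' := by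
  subst hS
  have hxy : x ≠ y := fun h => hy (h ▸ hx)
  have hxz : x ≠ z := fun h => hz (h ▸ hx)
  refine ⟨hl, ?_, ?_, ?_⟩
  · simp [hl, hxl.symm]
  · have : symmDiff S (insert y (insert z (S.erase x))) = {x, y, z} := by
      ext j
      simp only [Finset.mem_symmDiff, Finset.mem_insert, Finset.mem_erase, Finset.mem_singleton]
      grind
    rw [this, Finset.card_eq_three]
    exact ⟨x, y, z, hxy, hxz, hyz, rfl⟩
  · rw [Finset.sum_insert (by simp [hyz, hy]), Finset.sum_insert (by simp [hz]),
      ← Finset.add_sum_erase S _ hx]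
    omega

/-- Replace two jobs by a single one that is lighter than both together. -/
theorem LBStep.merge {n : ℕ} {S S' : Finset (LBJob n)} {x y z : LBJob n}
    (hl : LBJob.l ∈ S) (hxl : x ≠ LBJob.l) (hyl : y ≠ LBJob.l) (hx : x ∈ S) (hy : y ∈ S)
    (hz : z ∉ S) (hxy : x ≠ y)
    (hS : S' = insert z ((S.erase x).erase y))
    (hp : lbp n z < lbp n x + lbp n y) : LBStep n S S' := by
  subst hS
  have hxz : x ≠ z := fun h => hz (h ▸ hx)
  have hyz : y ≠ z := fun h => hz (h ▸ hy)
  refine ⟨hl, ?_, ?_, ?_⟩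
  · simp [hl, hxl.symm, hyl.symm]
  · have : symmDiff S (insert z ((S.erase x).erase y)) = {x, y, z} := by
      ext j
      simp only [Finset.mem_symmDiff, Finset.mem_insert, Finset.mem_erase, Finset.mem_singleton]
      grind
    rw [this, Finset.card_eq_three]
    exact ⟨x, y, z, hxy, hxz, hyz, rfl⟩
  · rw [Finset.sum_insert (by simp [hz]), ← Finset.add_sum_erase S _ hx,
      ← Finset.add_sum_erase (S.erase x) _ (Finset.mem_erase.2 ⟨hxy.symm, hy⟩)]
    omega

/-- Jobs of type `LBJob n` as a sum type. -/
def lbEquiv (n : ℕ) : LBJob n ≃ ((Fin n ⊕ Fin n) ⊕ Fin n) ⊕ Unit where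
  toFun
    | .a i => .inl (.inl (.inl i))
    | .b i => .inl (.inl (.inr i))
    | .c i => .inl (.inr i)
    | .l => .inr ()
  invFun
    | .inl (.inl (.inl i)) => .a i
    | .inl (.inl (.inr i)) => .b i
    | .inl (.inr i) => .c i
    | .inr () => .l
  left_inv x := by cases x <;> rfl
  right_inv x := by rcases x with ((x | x) | x) | x <;> rfl

theorem lb_card (n : ℕ) : Fintype.card (LBJob n) = 3 * n + 1 := by
  rw [Fintype.card_congr (lbEquiv n)]
  simp
  ring

theorem lb_total (n : ℕ) : ∑ j, lbp n j ≤ 2 * 2 ^ (2 * n + 4) := by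
  have hg : ∀ m : ℕ, ∑ i : Fin m, 2 ^ i.1 ≤ 2 ^ m := by
    intro m
    induction m with
    | zero => simp
    | succ m ih => rw [Fin.sum_univ_castSucc]; simp only [Fin.val_castSucc, Fin.val_last]; omega
  rw [← (lbEquiv n).symm.sum_comp]
  simp only [Fintype.sum_sum_type]
  simp only [lbEquiv, Equiv.symm, Equiv.coe_fn_mk, lbp, Finset.univ_unique, Finset.sum_singleton]
  simp only [Finset.sum_add_distrib, pow_add, ← Finset.mul_sum, ← Finset.sum_mul]
  have h := hg n
  set s := ∑ i : Fin n, 2 ^ i.1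
  have h1 : 1 ≤ 2 ^ n := Nat.one_le_two_pow
  have h2 : 2 ^ (2 * n) = 2 ^ n * 2 ^ n := by rw [two_mul, pow_add]
  rw [h2]
  generalize 2 ^ n = N at *
  nlinarith

/-- The schedule of a set of jobs. -/
def lbSched {n : ℕ} (S : Finset (LBJob n)) : LBJob n → Bool := fun j => decide (j ∈ S)

theorem lbCmax_sched {n : ℕ} {S : Finset (LBJob n)} (hl : LBJob.l ∈ S) :
    lbCmax n (lbSched S) = ∑ j ∈ S, lbp n j := by
  have h1 : lbLoad n true (lbSched S) = ∑ j ∈ S, lbp n j := by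
    unfold lbLoad
    congr 1
    ext j
    simp [lbSched]
  have h2 : lbLoad n false (lbSched S) = ∑ j ∈ Sᶜ, lbp n j := by
    unfold lbLoad
    congr 1
    ext j
    simp [lbSched]
  have h3 := Finset.sum_add_sum_compl S (lbp n)
  have h4 := lb_total n
  have h5 : lbp n LBJob.l ≤ ∑ j ∈ S, lbp n j :=
    Finset.single_le_sum (f := lbp n) (fun _ _ => Nat.zero_le _) hl
  have h6 : lbp n LBJob.l = 2 ^ (2 * n + 4) := rfl
  unfold lbCmax
  rw [h1, h2]
  omega

theorem LBChain.exists_sched {n T : ℕ} {S S' : Finset (LBJob n)} (h : LBChain n T S S') :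
    ∃ σ : ℕ → LBJob n → Bool, ∀ t < T,
        (Finset.univ.filter (fun j => σ t j ≠ σ (t + 1) j)).card = 3 ∧
        lbCmax n (σ (t + 1)) < lbCmax n (σ t) := by
  obtain ⟨f, -, hf⟩ := h.exists_fun
  refine ⟨fun t => lbSched (f t), fun t ht => ?_⟩
  obtain ⟨h1, h2, h3, h4⟩ := hf t ht
  refine ⟨?_, ?_⟩
  · rw [← h3]
    congr 1
    ext j
    simp only [lbSched, Finset.mem_filter, Finset.mem_univ, true_and, Finset.mem_symmDiff]
    by_cases ha : j ∈ f t <;> by_cases hb : j ∈ f (t + 1) <;> simp [ha, hb]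
  · simp only [lbCmax_sched h1, lbCmax_sched h2]
    exact h4

/-- `c (k+1)` is heavier than `c k` and `b (k-1)` together. -/
theorem lbp_split (n k : ℕ) (h : k + 2 < n) :
    lbp n (.c ⟨k + 1, by omega⟩) + lbp n (.b ⟨k, by omega⟩) < lbp n (.c ⟨k + 2, h⟩) := by
  simp only [lbp, pow_add]
  have := Nat.one_le_two_pow (n := k)
  generalize 2 ^ k = K at *
  generalize 2 ^ n = N at *
  nlinarith

/-- `b k` and `c 0` together are heavier than `c (k+1)`. -/
theorem lbp_restore (n k : ℕ) (h : k + 1 < n) :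
    lbp n (.c ⟨k + 1, h⟩) < lbp n (.b ⟨k, by omega⟩) + lbp n (.c ⟨0, by omega⟩) := by
  have h1 : 2 ^ (k + 1) ≤ 2 ^ n := Nat.pow_le_pow_right (by norm_num) (by omega)
  simp only [lbp, ← add_assoc, add_zero, pow_zero]
  omega

/-- The recursive procedure: replacing `c (k+2)` by `c 0` in `2^(k+2) - 2` improving steps. -/
theorem lb_rec (n k : ℕ) (hk : k + 2 < n) (S : Finset (LBJob n)) (hl : LBJob.l ∈ S)
    (hc : LBJob.c ⟨k + 2, hk⟩ ∈ S)
    (hcj : ∀ j (hj : j < k + 2), LBJob.c ⟨j, by omega⟩ ∉ S)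
    (hbj : ∀ j (hj : j < k + 1), LBJob.b ⟨j, by omega⟩ ∉ S) :
    LBChain n (2 ^ (k + 2) - 2) S
      (insert (.c ⟨0, by omega⟩) (S.erase (.c ⟨k + 2, hk⟩))) := by
  induction k generalizing S with
  | zero =>
    have h0 := hcj 0 (by omega)
    have h1 := hcj 1 (by omega)
    have hb := hbj 0 (by omega)
    refine LBChain.head (LBStep.split hl (by simp) hc h1 hb (by simp) rfl (lbp_split n 0 hk))
      (LBChain.single (LBStep.merge (x := .c ⟨1, by omega⟩) (y := .b ⟨0, by omega⟩)
        (z := .c ⟨0, by omega⟩) ?_ (by simp) (by simp) ?_ ?_ ?_ (by simp) ?_ ?_))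
    · simp [hl]
    · simp
    · simp
    · simp [h0]
    · ext j
      simp only [Finset.mem_insert, Finset.mem_erase]
      grind
    · simp only [lbp, pow_add]
      have := Nat.one_le_two_pow (n := n)
      omega
  | succ k ih =>
    have h0 := hcj 0 (by omega)
    have hc2 := hcj (k + 2) (by omega)
    have hb1 := hbj (k + 1) (by omega)
    set S1 : Finset (LBJob n) := insert (.c ⟨k + 2, by omega⟩)
      (insert (.b ⟨k + 1, by omega⟩) (S.erase (.c ⟨k + 3, hk⟩))) with hS1
    have c1 : LBChain n 1 S S1 :=
      LBChain.single (LBStep.split hl (by simp) hc hc2 hb1 (by simp) rfl (lbp_split n (k + 1) hk))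
    have c2 := ih (by omega) S1 (by simp [hS1, hl]) (by simp [hS1])
      (by
        intro j hj
        have := hcj j (by omega)
        simp only [hS1, Finset.mem_insert, Finset.mem_erase, LBJob.c.injEq, Fin.mk.injEq, this]
        simp
        omega)
      (by
        intro j hj
        have := hbj j (by omega)
        simp only [hS1, Finset.mem_insert, Finset.mem_erase, LBJob.b.injEq, Fin.mk.injEq, this]
        simp
        omega)
    set S2 : Finset (LBJob n) := insert (.c ⟨0, by omega⟩) (S1.erase (.c ⟨k + 2, by omega⟩)) with hS2
    set S3 : Finset (LBJob n) := insert (.c ⟨k + 2, by omega⟩)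
      ((S2.erase (.b ⟨k + 1, by omega⟩)).erase (.c ⟨0, by omega⟩)) with hS3
    have c3 : LBChain n 1 S2 S3 :=
      LBChain.single (LBStep.merge (by simp [hS2, hS1, hl]) (by simp) (by simp)
        (by simp [hS2, hS1]) (by simp [hS2]) (by simp [hS2]) (by simp) rfl
        (lbp_restore n (k + 1) (by omega)))
    have c4 := ih (by omega) S3 (by simp [hS3, hS2, hS1, hl]) (by simp [hS3])
      (by
        intro j hj
        have := hcj j (by omega)
        simp only [hS3, hS2, hS1, Finset.mem_insert, Finset.mem_erase, LBJob.c.injEq, Fin.mk.injEq,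
          this]
        simp
        omega)
      (by
        intro j hj
        have := hbj j (by omega)
        simp only [hS3, hS2, hS1, Finset.mem_insert, Finset.mem_erase, LBJob.b.injEq, Fin.mk.injEq,
          this]
        simp)
    have hfin := ((c1.trans c2).trans c3).trans c4
    have hlen : 1 + (2 ^ (k + 2) - 2) + 1 + (2 ^ (k + 2) - 2) = 2 ^ (k + 1 + 2) - 2 := by
      have : 4 ≤ 2 ^ (k + 2) := by
        have := Nat.one_le_two_pow (n := k)
        rw [pow_add]; omega
      have h' : 2 ^ (k + 1 + 2) = 2 * 2 ^ (k + 2) := by ring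
      omega
    rw [hlen] at hfin
    convert hfin using 1
    ext j
    simp only [hS3, hS2, hS1, Finset.mem_insert, Finset.mem_erase]
    grind

theorem lb_chain_one : ∃ S S', LBChain 1 1 S S' :=
  ⟨{.l, .a 0}, _, LBChain.single (LBStep.split (x := .a 0) (y := .b 0) (z := .c 0)
    (by simp) (by simp) (by simp) (by simp) (by simp) (by simp) rfl (by simp [lbp]))⟩

theorem lb_chain_two : ∃ S S', LBChain 2 3 S S' :=
  ⟨{.l, .a 1}, _,
    LBChain.head (LBStep.split (x := .a 1) (y := .b 1) (z := .a 0)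
      (by decide) (by decide) (by decide) (by decide) (by decide) (by decide) rfl (by decide))
    (LBChain.head (LBStep.split (x := .a 0) (y := .b 0) (z := .c 0)
      (by decide) (by decide) (by decide) (by decide) (by decide) (by decide) rfl (by decide))
    (LBChain.single (LBStep.merge (x := .b 1) (y := .b 0) (z := .a 0)
      (by decide) (by decide) (by decide) (by decide) (by decide) (by decide) (by decide) rfl
      (by decide))))⟩

theorem lb_chain_general (m : ℕ) : ∃ S S', LBChain (m + 3) (2 ^ (m + 3) - 1) S S' := by
  -- the schedule after the two preliminary steps
  set S : Finset (LBJob (m + 3)) :=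
    {.l, .a ⟨0, by omega⟩, .c ⟨m + 2, by omega⟩, .b ⟨m + 1, by omega⟩} with hS
  have c0 : LBChain (m + 3) 2 {.l, .a ⟨m + 2, by omega⟩, .c ⟨m + 2, by omega⟩,
      .b ⟨m + 1, by omega⟩} S := by
    refine LBChain.head (LBStep.split (x := .a ⟨m + 2, by omega⟩) (y := .b ⟨m + 2, by omega⟩)
        (z := .a ⟨m + 1, by omega⟩) (by simp) (by simp) (by simp) (by simp) (by simp) (by simp)
        rfl ?_)
      (LBChain.single (LBStep.merge (x := .b ⟨m + 2, by omega⟩) (y := .a ⟨m + 1, by omega⟩)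
        (z := .a ⟨0, by omega⟩) (by simp) (by simp) (by simp) (by simp) (by simp) (by simp)
        (by simp) ?_ ?_))
    · simp only [lbp, pow_add]
      have := Nat.one_le_two_pow (n := m)
      generalize 2 ^ m = M at *
      nlinarith
    · ext j
      simp only [hS, Finset.mem_insert, Finset.mem_erase, Finset.mem_singleton]
      grind
    · simp only [lbp, pow_add]
      have := Nat.one_le_two_pow (n := m)
      generalize 2 ^ m = M at *
      nlinarith
  have c2 := lb_rec (m + 3) m (by omega) S (by simp [hS]) (by simp [hS])
    (by intro j hj; simp [hS]; omega) (by intro j hj; simp [hS]; omega)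
  set S2 : Finset (LBJob (m + 3)) :=
    insert (.c ⟨0, by omega⟩) (S.erase (.c ⟨m + 2, by omega⟩)) with hS2
  set S3 : Finset (LBJob (m + 3)) := insert (.c ⟨m + 2, by omega⟩)
    ((S2.erase (.b ⟨m + 1, by omega⟩)).erase (.c ⟨0, by omega⟩)) with hS3
  have c3 : LBChain (m + 3) 1 S2 S3 :=
    LBChain.single (LBStep.merge (by simp [hS2, hS]) (by simp) (by simp)
      (by simp [hS2, hS]) (by simp [hS2]) (by simp [hS2]) (by simp) rfl
      (lbp_restore (m + 3) (m + 1) (by omega)))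
  have c4 := lb_rec (m + 3) m (by omega) S3 (by simp [hS3, hS2, hS]) (by simp [hS3])
    (by intro j hj; simp [hS3, hS2, hS]; omega) (by intro j hj; simp [hS3, hS2, hS])
  have hfin := ((c0.trans c2).trans c3).trans c4
  have hlen : 2 + (2 ^ (m + 2) - 2) + 1 + (2 ^ (m + 2) - 2) = 2 ^ (m + 3) - 1 := by
    have : 4 ≤ 2 ^ (m + 2) := by
      have := Nat.one_le_two_pow (n := m)
      rw [pow_add]; omega
    have h' : 2 ^ (m + 3) = 2 * 2 ^ (m + 2) := by ring
    omega
  rw [hlen] at hfin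
  exact ⟨_, _, hfin⟩

theorem lb_chain (n : ℕ) (hn : 1 ≤ n) : ∃ S S', LBChain n (2 ^ n - 1) S S' := by
  match n, hn with
  | 1, _ => exact lb_chain_one
  | 2, _ => exact lb_chain_two
  | m + 3, _ => exact lb_chain_general m

/-- Exponential lower bound: for every `n ≥ 1`, the lower-bound instance has `3n + 1`
jobs and admits a sequence of at least `2^n - 1` improving 3-swaps, each changing the
assignment of exactly 3 jobs and strictly decreasing the makespan. Hence the number of
improving 3-swaps until a 3-swap optimal solution is reached can be `2^Ω(n)`. -/
theorem lb_exponential (n : ℕ) (hn : 1 ≤ n) :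
    Fintype.card (LBJob n) = 3 * n + 1 ∧
    ∃ (T : ℕ) (σ : ℕ → LBJob n → Bool), 2 ^ n - 1 ≤ T ∧
      ∀ t < T,
        (Finset.univ.filter (fun j => σ t j ≠ σ (t + 1) j)).card = 3 ∧
        lbCmax n (σ (t + 1)) < lbCmax n (σ t) := by
  refine ⟨lb_card n, ?_⟩
  obtain ⟨S, S', h⟩ := lb_chain n hn
  obtain ⟨σ, hσ⟩ := h.exists_sched
  exact ⟨2 ^ n - 1, σ, le_rfl, hσ⟩
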